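/- Let F : ℝ^d → ℝ be nonnegative and continuously differentiable, with ‖∇F(x) − ∇F(y)‖ ≤ M‖x−y‖ for all x,y, ⟨x, ∇F(x)⟩ ≥ m‖x‖² − b for all x, F(x) ≤ (M/2)‖x‖² + B‖x‖ + A for all x, and F(x) ≥ (m/2)‖x‖² − (b/2)·log 3 for all x, where m, b, M, B, A > 0. Let J be a d×d real antisymmetric matrix, A_J := I + J, β > 0, 0 < η ≤ 1/(M‖A_J‖²), and R := √(b/m). Define X₀ = x with ‖x‖ ≤ R and X_{k+1} = X_k − ηA_J∇F(X_k) + √(2ηβ^{−1})ξ_k, where (ξ_k)_{k≥0} are i.i.d. standard Gaussian random vectors in ℝ^d. Then for every k ≥ 0: E[‖X_k‖²] ≤ (MR² + 2BR + B + 4A)/m + 8(M+B)Mβ^{−1}d/m³ + 2(M+B)b/m² + (b/m)·log 3. -/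

import Mathlib

open MeasureTheory ProbabilityTheory Matrix
open scoped RealInnerProductSpace ENNReal NNReal
open Gradient

noncomputable section

/-- Spectral norm (largest singular value) of a real matrix. -/
def specNorm {ι : Type*} [Fintype ι] [DecidableEq ι] (A : Matrix ι ι ℝ) : ℝ :=
  ‖Matrix.toEuclideanCLM (𝕜 := ℝ) A‖

/-- The standard Gaussian measure on `EuclideanSpace ℝ (Fin d)`. -/
def stdGaussianE (d : ℕ) : Measure (EuclideanSpace ℝ (Fin d)) :=
  (Measure.pi fun _ : Fin d => gaussianReal 0 1).map
    (MeasurableEquiv.toLp 2 (Fin d → ℝ))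


abbrev EE (d : ℕ) := EuclideanSpace ℝ (Fin d)

lemma descent_aux {d : ℕ} (F : EE d → ℝ) (hF : ContDiff ℝ 1 F) (M : ℝ)
    (hlip : ∀ x y, ‖∇ F x - ∇ F y‖ ≤ M * ‖x - y‖) (x v : EE d) :
    F (x + v) ≤ F x + ⟪∇ F x, v⟫ + M / 2 * ‖v‖ ^ 2 := by
  have hd : ∀ y, HasFDerivAt F (InnerProductSpace.toDual ℝ _ (∇ F y)) y := fun y =>
    ((hF.differentiable (by norm_num)) y).hasGradientAt.hasFDerivAt
  let φ : ℝ → ℝ := fun t => F (x + t • v) - t * ⟪∇ F x, v⟫ - M / 2 * t ^ 2 * ‖v‖ ^ 2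
  have hφ : ∀ t, HasDerivAt φ (⟪∇ F (x + t • v), v⟫ - ⟪∇ F x, v⟫ - M * t * ‖v‖ ^ 2) t := by
    intro t
    have h1 : HasDerivAt (fun t : ℝ => x + t • v) v t := by
      simpa using ((hasDerivAt_id t).smul_const v).const_add x
    have h2 := (hd (x + t • v)).comp_hasDerivAt t h1
    have h3 := (hasDerivAt_id t).mul_const ⟪∇ F x, v⟫
    have h4 := (((hasDerivAt_id t).pow 2).const_mul (M / 2)).mul_const (‖v‖ ^ 2)
    have h5 := (h2.sub h3).sub h4
    have e : ⟪∇ F (x + t • v), v⟫ - ⟪∇ F x, v⟫ - M * t * ‖v‖ ^ 2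
        = (InnerProductSpace.toDual ℝ _ (∇ F (x + t • v))) v - 1 * ⟪∇ F x, v⟫
          - M / 2 * (((2 : ℕ) : ℝ) * id t ^ (2 - 1) * 1) * ‖v‖ ^ 2 := by
      rw [InnerProductSpace.toDual_apply_apply]
      simp only [id, Nat.cast_ofNat, Nat.add_one_sub_one, pow_one]
      ring
    rw [e]
    exact h5
  have hanti : AntitoneOn φ (Set.Icc 0 1) := by
    apply antitoneOn_of_deriv_nonpos (convex_Icc 0 1)
    · exact fun t _ => (hφ t).continuousAt.continuousWithinAt
    · exact fun t _ => (hφ t).differentiableAt.differentiableWithinAt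
    · intro t ht
      rw [interior_Icc] at ht
      rw [(hφ t).deriv, ← inner_sub_left]
      have h1 := real_inner_le_norm (∇ F (x + t • v) - ∇ F x) v
      have h2 := hlip (x + t • v) x
      rw [add_sub_cancel_left, norm_smul, Real.norm_of_nonneg ht.1.le] at h2
      have h3 := mul_le_mul_of_nonneg_right h2 (norm_nonneg v)
      nlinarith
  have h := hanti (a := 0) (b := 1) (by simp) (by simp) zero_le_one
  simp only [φ, one_smul, zero_smul, add_zero, one_mul, zero_mul, one_pow, mul_one, sub_zero,
    ne_eq, OfNat.ofNat_ne_zero, not_false_eq_true, zero_pow, mul_zero] at h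
  linarith

lemma skew_aux {d : ℕ} (J AJ : Matrix (Fin d) (Fin d) ℝ) (hJ : Jᵀ = -J) (hAJ : AJ = 1 + J)
    (v : EE d) : ⟪v, Matrix.toEuclideanCLM (𝕜 := ℝ) AJ v⟫ = ‖v‖ ^ 2 := by
  have h : v.ofLp ⬝ᵥ J *ᵥ v.ofLp = 0 := by
    have h1 : v.ofLp ⬝ᵥ J *ᵥ v.ofLp = v.ofLp ⬝ᵥ Jᵀ *ᵥ v.ofLp := by
      rw [Matrix.mulVec_transpose, dotProduct_comm v.ofLp (v.ofLp ᵥ* J), Matrix.dotProduct_mulVec]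
    rw [hJ, Matrix.neg_mulVec, dotProduct_neg] at h1
    linarith
  rw [Matrix.inner_toEuclideanCLM, hAJ, Matrix.add_mulVec, dotProduct_add, h, Matrix.one_mulVec,
    EuclideanSpace.real_norm_sq_eq]
  simp [dotProduct, pow_two]

lemma coord_law {Ω : Type*} [MeasurableSpace Ω] (P : Measure Ω) {d : ℕ} (z : Ω → EE d)
    (hz : Measurable z) (hl : Measure.map z P = stdGaussianE d) (i : Fin d) :
    Measure.map (fun ω => z ω i) P = gaussianReal 0 1 := by
  have hm : Measurable (fun y : EE d => y i) := by fun_prop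
  have : Measure.map (fun y : EE d => y i) (Measure.map z P) = gaussianReal 0 1 := by
    rw [hl, stdGaussianE, Measure.map_map hm (MeasurableEquiv.measurable _)]
    exact (measurePreserving_eval (fun _ : Fin d => gaussianReal 0 1) i).map_eq
  rwa [Measure.map_map hm hz] at this

lemma coord_facts {Ω : Type*} [MeasurableSpace Ω] (P : Measure Ω) {d : ℕ} (z : Ω → EE d)
    (hz : Measurable z) (hl : Measure.map z P = stdGaussianE d) (i : Fin d) :
    MemLp (fun ω => z ω i) 2 P ∧ ∫ ω, z ω i ∂P = 0 ∧ ∫ ω, (z ω i) ^ 2 ∂P = 1 := by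
  have hm : Measurable (fun ω => z ω i) := by fun_prop
  have h := coord_law P z hz hl i
  have hid : MemLp id 2 (gaussianReal 0 1) := memLp_id_gaussianReal' 2 (by simp)
  refine ⟨?_, ?_, ?_⟩
  · rw [← h] at hid
    exact hid.comp_of_map hm.aemeasurable
  · have := integral_id_gaussianReal (μ := 0) (v := 1)
    rw [← h, integral_map hm.aemeasurable (by fun_prop)] at this
    exact this
  · have := variance_id_gaussianReal (μ := 0) (v := 1)
    rw [variance_of_integral_eq_zero (by fun_prop) (by simp), ← h,
      integral_map hm.aemeasurable (by fun_prop)] at this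
    simpa using this

lemma noise_memLp {Ω : Type*} [MeasurableSpace Ω] (P : Measure Ω) {d : ℕ} (z : Ω → EE d)
    (hz : Measurable z) (hl : Measure.map z P = stdGaussianE d) :
    MemLp z 2 P ∧ ∫ ω, ‖z ω‖ ^ 2 ∂P = d := by
  have hi : ∀ i, Integrable (fun ω => (z ω i) ^ 2) P := fun i =>
    (coord_facts P z hz hl i).1.integrable_sq
  constructor
  · rw [memLp_two_iff_integrable_sq_norm hz.aestronglyMeasurable]
    simp_rw [EuclideanSpace.real_norm_sq_eq]
    exact integrable_finsetSum _ fun i _ => hi i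
  · simp_rw [EuclideanSpace.real_norm_sq_eq]
    rw [integral_finsetSum _ fun i _ => hi i]
    simp [fun i => (coord_facts P z hz hl i).2.2]

lemma cross_zero {Ω : Type*} [MeasurableSpace Ω] (P : Measure Ω) {d : ℕ} (u z : Ω → EE d)
    (hz : Measurable z) (hl : Measure.map z P = stdGaussianE d)
    (hu : MemLp u 2 P) (hind : IndepFun u z P) :
    Integrable (fun ω => ⟪u ω, z ω⟫) P ∧ ∫ ω, ⟪u ω, z ω⟫ ∂P = 0 := by
  have hui : ∀ i, MemLp (fun ω => u ω i) 2 P := fun i =>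
    hu.mono (by have := hu.1; fun_prop) (.of_forall fun ω => PiLp.norm_apply_le (u ω) i)
  have hI : ∀ i, Integrable (fun ω => u ω i * z ω i) P := fun i =>
    (hui i).integrable_mul (coord_facts P z hz hl i).1
  have h0 : ∀ i, ∫ ω, u ω i * z ω i ∂P = 0 := by
    intro i
    have hc : IndepFun (fun ω => u ω i) (fun ω => z ω i) P :=
      hind.comp (φ := fun y : EE d => y i) (ψ := fun y : EE d => y i) (by fun_prop) (by fun_prop)
    have := hc.integral_mul_eq_mul_integral (hui i).1 (coord_facts P z hz hl i).1.1
    rw [(coord_facts P z hz hl i).2.1, mul_zero] at this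
    exact this
  have he : ∀ ω, ⟪u ω, z ω⟫ = ∑ i, u ω i * z ω i := by
    intro ω
    simp [PiLp.inner_apply, mul_comm]
  simp_rw [he]
  refine ⟨integrable_finsetSum _ fun i _ => hI i, ?_⟩
  rw [integral_finsetSum _ fun i _ => hI i]
  simp [h0]

lemma indep_aux {Ω : Type*} [MeasurableSpace Ω] (P : Measure Ω) {d : ℕ}
    (ξ : ℕ → Ω → EE d) (hξmeas : ∀ k, Measurable (ξ k))
    (hξindep : iIndepFun (m := fun _ => inferInstance) ξ P)
    (X : ℕ → Ω → EE d) (x : EE d) (T : EE d → EE d → EE d)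
    (hT : Measurable (Function.uncurry T))
    (hX0 : ∀ ω, X 0 ω = x) (hX : ∀ k ω, X (k + 1) ω = T (X k ω) (ξ k ω)) (k : ℕ) :
    Measurable (X k) ∧ IndepFun (X k) (ξ k) P := by
  have key : ∀ k, ∃ g : (Finset.range k → EE d) → EE d, Measurable g ∧
      ∀ ω, X k ω = g (fun i => ξ i ω) := by
    intro k
    induction k with
    | zero => exact ⟨fun _ => x, measurable_const, hX0⟩
    | succ k ih =>
      obtain ⟨g, hg, hgX⟩ := ih
      refine ⟨fun t => Function.uncurry T (g (fun i => t ⟨i, by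
          have := i.2; simp only [Finset.mem_range] at this ⊢; omega⟩), t ⟨k, by simp⟩), ?_, ?_⟩
      · apply hT.comp
        apply Measurable.prodMk
        · apply hg.comp
          fun_prop
        · fun_prop
      · intro ω
        rw [hX, hgX]
        rfl
  obtain ⟨g, hg, hgX⟩ := key k
  have hXe : X k = g ∘ (fun ω (i : Finset.range k) => ξ i ω) := funext hgX
  constructor
  · rw [hXe]
    apply hg.comp
    exact measurable_pi_lambda _ fun i => hξmeas i
  · rw [hXe]
    have h := hξindep.indepFun_finset (Finset.range k) {k} (by simp) hξmeas
    exact h.comp (φ := g) (ψ := fun t : (({k} : Finset ℕ) → EE d) => t ⟨k, by simp⟩) hg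
      (measurable_pi_apply _)

set_option maxHeartbeats 4000000 in
/-- Uniform second-moment bound along the non-reversible Langevin
dynamics. -/
theorem nld_uniform_L2_bound
    {Ω : Type*} [MeasurableSpace Ω] (P : Measure Ω) [IsProbabilityMeasure P]
    {d : ℕ}
    (F : EuclideanSpace ℝ (Fin d) → ℝ) (hF : ContDiff ℝ 1 F)
    (hFnonneg : ∀ x, 0 ≤ F x)
    (m b M B A : ℝ)
    (hm : 0 < m) (hb : 0 < b) (hM : 0 < M) (hB : 0 < B) (hA : 0 < A)
    -- Lipschitz gradient
    (hlip : ∀ x y, ‖∇ F x - ∇ F y‖ ≤ M * ‖x - y‖)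
    -- dissipativity
    (hdiss : ∀ x, ⟪x, ∇ F x⟫ ≥ m * ‖x‖ ^ 2 - b)
    -- quadratic growth
    (hgrowth : ∀ x, F x ≤ M / 2 * ‖x‖ ^ 2 + B * ‖x‖ + A)
    -- quadratic lower bound
    (hlower : ∀ x, F x ≥ m / 2 * ‖x‖ ^ 2 - b / 2 * Real.log 3)
    -- J antisymmetric, A_J = I + J
    (J : Matrix (Fin d) (Fin d) ℝ) (hJ : Jᵀ = -J)
    (AJ : Matrix (Fin d) (Fin d) ℝ) (hAJ : AJ = 1 + J)
    (β η : ℝ) (hβ : 0 < β) (hη0 : 0 < η) (hη : η ≤ 1 / (M * specNorm AJ ^ 2))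
    (R : ℝ) (hR : R = Real.sqrt (b / m))
    -- i.i.d. standard Gaussian noise
    (ξ : ℕ → Ω → EuclideanSpace ℝ (Fin d)) (hξmeas : ∀ k, Measurable (ξ k))
    (hξindep : iIndepFun (m := fun _ => inferInstance) ξ P)
    (hξ : ∀ k, Measure.map (ξ k) P = stdGaussianE d)
    -- the NLD iterates, started within the ball of radius R
    (x : EuclideanSpace ℝ (Fin d)) (hx : ‖x‖ ≤ R)
    (X : ℕ → Ω → EuclideanSpace ℝ (Fin d))
    (hX0 : ∀ ω, X 0 ω = x)
    (hXrec : ∀ k ω, X (k + 1) ω =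
      X k ω - η • (Matrix.toEuclideanCLM (𝕜 := ℝ) AJ) (∇ F (X k ω)) +
        Real.sqrt (2 * η * β⁻¹) • ξ k ω) :
    ∀ k : ℕ, (∫ ω, ‖X k ω‖ ^ 2 ∂P) ≤
      (M * R ^ 2 + 2 * B * R + B + 4 * A) / m + 8 * (M + B) * M * β⁻¹ * d / m ^ 3 +
        2 * (M + B) * b / m ^ 2 + b / m * Real.log 3 := by
  set L := Matrix.toEuclideanCLM (𝕜 := ℝ) AJ with hL
  have hLn : specNorm AJ = ‖L‖ := rfl
  rw [hLn] at hη
  have hskew := skew_aux J AJ hJ hAJ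
  rw [← hL] at hskew
  have hLpos : 0 < ‖L‖ := by
    rcases (norm_nonneg L).eq_or_lt with h | h
    · rw [← h] at hη
      norm_num at hη
      linarith
    · exact h
  have hηL : η * (M * ‖L‖ ^ 2) ≤ 1 := (le_div_iff₀ (by positivity)).1 hη
  obtain ⟨v, hv⟩ : ∃ v : EE d, ‖v‖ = 1 := by
    have : Nontrivial (EE d) := by
      by_contra hn
      rw [not_nontrivial_iff_subsingleton] at hn
      have : L = 0 := by ext v; simp [Subsingleton.elim v 0]
      simp [this] at hLpos
    exact exists_norm_eq (EE d) zero_le_one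
  have hL1 : 1 ≤ ‖L‖ := by
    have h1 := hskew v
    have h2 := real_inner_le_norm v (L v)
    have h3 := L.le_opNorm v
    rw [hv] at h1 h2 h3
    linarith
  have hηM : η * M ≤ 1 := by
    have : 1 ≤ ‖L‖ ^ 2 := one_le_pow₀ hL1
    have := mul_le_mul_of_nonneg_left this (mul_pos hη0 hM).le
    linarith
  have hg0 : ∀ y, ‖∇ F y‖ ≤ M * ‖y‖ + ‖∇ F 0‖ := by
    intro y
    have h1 := hlip y 0
    rw [sub_zero] at h1
    have h2 := norm_le_norm_add_norm_sub' (∇ F y) (∇ F 0)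
    linarith
  have hmM : m ≤ M := by
    by_contra! hlt
    set c := ‖∇ F 0‖
    have hc : 0 ≤ c := norm_nonneg _
    set t := (c + b + 1) / (m - M) + 1 with ht
    have hmM0 : 0 < m - M := by linarith
    have ht1 : 1 ≤ t := by
      have : 0 ≤ (c + b + 1) / (m - M) := by positivity
      linarith
    have ht2 : c + b + 1 ≤ (m - M) * t := by
      rw [ht, mul_add, mul_div_cancel₀ _ hmM0.ne']
      linarith
    have h1 := hdiss (t • v)
    have h2 := real_inner_le_norm (t • v) (∇ F (t • v))
    have h3 := hg0 (t • v)
    have h4 : ‖t • v‖ = t := by rw [norm_smul, hv, Real.norm_of_nonneg (by linarith), mul_one]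
    rw [h4] at h1 h2 h3
    nlinarith [mul_le_mul_of_nonneg_left h3 (by linarith : 0 ≤ t)]
  have hgc : Continuous (∇ F) := by
    have : LipschitzWith (Real.toNNReal M) (∇ F) := by
      apply LipschitzWith.of_dist_le_mul
      intro y z
      rw [dist_eq_norm, dist_eq_norm, Real.coe_toNNReal _ hM.le]
      exact hlip y z
    exact this.continuous
  set s := Real.sqrt (2 * η * β⁻¹) with hs
  have hs2 : s ^ 2 = 2 * η * β⁻¹ := Real.sq_sqrt (by positivity)
  have hbasic : ∀ k, Measurable (X k) ∧ IndepFun (X k) (ξ k) P := by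
    refine indep_aux P ξ hξmeas hξindep X x (fun y z => y - η • L (∇ F y) + s • z) ?_ hX0 hXrec
    apply Continuous.measurable
    simp only [Function.uncurry_def]
    fun_prop
  have hgLp : ∀ k, MemLp (X k) 2 P → MemLp (fun ω => ∇ F (X k ω)) 2 P := by
    intro k h
    have h1 : MemLp (fun ω => M * ‖X k ω‖ + ‖∇ F 0‖) 2 P :=
      (h.norm.const_mul M).add (memLp_const _)
    exact h1.mono' (hgc.measurable.comp (hbasic k).1).aestronglyMeasurable
      (.of_forall fun ω => hg0 _)
  have hLp : ∀ k, MemLp (X k) 2 P := by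
    intro k
    induction k with
    | zero =>
      have : X 0 = fun _ => x := funext hX0
      rw [this]
      exact memLp_const x
    | succ k ih =>
      have : X (k + 1) = fun ω => X k ω - η • L (∇ F (X k ω)) + s • ξ k ω := funext (hXrec k)
      rw [this]
      exact (ih.sub ((L.comp_memLp' (hgLp k ih)).const_smul η)).add
        ((noise_memLp P _ (hξmeas k) (hξ k)).1.const_smul s)
  have hsq : ∀ k, Integrable (fun ω => ‖X k ω‖ ^ 2) P := fun k => (hLp k).integrable_norm_pow (by simp)
  have hgrow2 : ∀ y, F y ≤ (M + B) / 2 * ‖y‖ ^ 2 + (B / 2 + A) := by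
    intro y
    nlinarith [hgrowth y, sq_nonneg (‖y‖ - 1)]
  have hFint : ∀ k, Integrable (fun ω => F (X k ω)) P := by
    intro k
    refine Integrable.mono' (((hsq k).const_mul ((M + B) / 2)).add (integrable_const (B / 2 + A)))
      (hF.continuous.measurable.comp (hbasic k).1).aestronglyMeasurable (.of_forall fun ω => ?_)
    rw [Real.norm_of_nonneg (hFnonneg _)]
    exact hgrow2 _
  set q := η * m ^ 2 / (M + B) with hq
  have hq0 : 0 < q := by positivity
  have hq1 : q ≤ 1 := by
    rw [hq, div_le_one (by positivity)]
    have : η * m ^ 2 ≤ η * M ^ 2 := by gcongr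
    nlinarith
  set C := B / 2 + A + (M + B) * b / m + (M + B) * M * β⁻¹ * d / m ^ 2 with hC
  have hC0 : 0 ≤ C := by positivity
  -- one-step pointwise bound
  have hpt : ∀ k ω, F (X (k + 1) ω) ≤ (1 - q) * F (X k ω) + q * (B / 2 + A + (M + B) * b / m)
      + s * ⟪∇ F (X k ω) - (M * η) • L (∇ F (X k ω)), ξ k ω⟫ + M / 2 * s ^ 2 * ‖ξ k ω‖ ^ 2 := by
    intro k ω
    set y := X k ω
    set g := ∇ F y
    set z := ξ k ω
    have h1 := descent_aux F hF M hlip y (s • z - η • L g)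
    have h2 : X (k + 1) ω = y + (s • z - η • L g) := by rw [hXrec]; abel
    rw [h2]
    have h3 : ⟪g, s • z - η • L g⟫ = s * ⟪g, z⟫ - η * ‖g‖ ^ 2 := by
      rw [inner_sub_right, inner_smul_right, inner_smul_right, hskew]
    have h4 : ‖s • z - η • L g‖ ^ 2 = s ^ 2 * ‖z‖ ^ 2 - 2 * s * η * ⟪L g, z⟫ + η ^ 2 * ‖L g‖ ^ 2 := by
      rw [norm_sub_sq_real, norm_smul, norm_smul, mul_pow, mul_pow, inner_smul_left,
        inner_smul_right, real_inner_comm]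
      simp
      ring
    have h5 : ⟪g - (M * η) • L g, z⟫ = ⟪g, z⟫ - M * η * ⟪L g, z⟫ := by
      rw [inner_sub_left, inner_smul_left]
      simp
    rw [h3, h4] at h1
    rw [h5]
    have h6 : ‖L g‖ ^ 2 ≤ ‖L‖ ^ 2 * ‖g‖ ^ 2 := by
      rw [← mul_pow]
      gcongr
      exact L.le_opNorm g
    have h7 : M * η ^ 2 * ‖L g‖ ^ 2 ≤ η * ‖g‖ ^ 2 := by
      calc M * η ^ 2 * ‖L g‖ ^ 2 ≤ M * η ^ 2 * (‖L‖ ^ 2 * ‖g‖ ^ 2) := by gcongr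
        _ = (η * (M * ‖L‖ ^ 2)) * (η * ‖g‖ ^ 2) := by ring
        _ ≤ 1 * (η * ‖g‖ ^ 2) := by gcongr
        _ = _ := one_mul _
    have h8 : m ^ 2 * ‖y‖ ^ 2 - 2 * m * b ≤ ‖g‖ ^ 2 := by
      have := hdiss y
      have h' := real_inner_le_norm y g
      have h'' : m * (m * ‖y‖ ^ 2 - b) ≤ m * (‖y‖ * ‖g‖) :=
        mul_le_mul_of_nonneg_left (this.le.trans h') hm.le
      have h3' := sq_nonneg (m * ‖y‖ - ‖g‖)
      ring_nf at h'' h3' ⊢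
      linarith
    have h9 : q * F y ≤ η * m ^ 2 / 2 * ‖y‖ ^ 2 + q * (B / 2 + A) := by
      have := mul_le_mul_of_nonneg_left (hgrow2 y) hq0.le
      have e : q * ((M + B) / 2 * ‖y‖ ^ 2 + (B / 2 + A))
          = η * m ^ 2 / 2 * ‖y‖ ^ 2 + q * (B / 2 + A) := by
        rw [hq]; field_simp
      linarith
    have h10 : q * ((M + B) * b / m) = η * m * b := by
      rw [hq]; field_simp
    have h11 := mul_le_mul_of_nonneg_left h8 hη0.le
    rw [mul_add q (B / 2 + A), h10]
    linarith
  have hstep : ∀ k, ∫ ω, F (X (k + 1) ω) ∂P ≤ (1 - q) * ∫ ω, F (X k ω) ∂P + q * C := by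
    intro k
    have hu : MemLp (fun ω => ∇ F (X k ω) - (M * η) • L (∇ F (X k ω))) 2 P :=
      (hgLp k (hLp k)).sub ((L.comp_memLp' (hgLp k (hLp k))).const_smul (M * η))
    have hui : IndepFun (fun ω => ∇ F (X k ω) - (M * η) • L (∇ F (X k ω))) (ξ k) P :=
      (hbasic k).2.comp (φ := fun y => ∇ F y - (M * η) • L (∇ F y)) (ψ := id)
        (Continuous.measurable (by fun_prop)) measurable_id
    obtain ⟨hc1, hc2⟩ := cross_zero P _ (ξ k) (hξmeas k) (hξ k) hu hui
    obtain ⟨hn1, hn2⟩ := noise_memLp P (ξ k) (hξmeas k) (hξ k)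
    have hn3 : Integrable (fun ω => ‖ξ k ω‖ ^ 2) P := hn1.integrable_norm_pow (by simp)
    have i1 := (hFint k).const_mul (1 - q)
    have i2 : Integrable (fun _ : Ω => q * (B / 2 + A + (M + B) * b / m)) P := integrable_const _
    have i3 := hc1.const_mul s
    have i4 := hn3.const_mul (M / 2 * s ^ 2)
    have hmono := integral_mono (hFint (k + 1)) (((i1.add i2).add i3).add i4) (hpt k)
    refine hmono.trans (le_of_eq ?_)
    rw [integral_add' ((i1.add i2).add i3) i4, integral_add' (i1.add i2) i3, integral_add' i1 i2,
      integral_const_mul, integral_const_mul, integral_const_mul, integral_const_mul, hc2, hn2, integral_const, hs2, hC, hq]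
    simp
    field_simp
    ring
  have hF0 : ∫ ω, F (X 0 ω) ∂P ≤ M / 2 * R ^ 2 + B * R + A := by
    simp_rw [hX0]
    simp only [integral_const, probReal_univ, one_smul]
    refine (hgrowth x).trans ?_
    gcongr
  have hR0 : 0 ≤ R := hR ▸ Real.sqrt_nonneg _
  have hall : ∀ k, ∫ ω, F (X k ω) ∂P ≤ M / 2 * R ^ 2 + B * R + A + C := by
    intro k
    induction k with
    | zero => linarith
    | succ k ih =>
      have h1 := hstep k
      have h2 := mul_le_mul_of_nonneg_left ih (by linarith : 0 ≤ 1 - q)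
      have h3 : 0 ≤ q * (M / 2 * R ^ 2 + B * R + A) := by positivity
      linarith
  intro k
  have hlow : ∫ ω, (m / 2 * ‖X k ω‖ ^ 2 - b / 2 * Real.log 3) ∂P ≤ ∫ ω, F (X k ω) ∂P :=
    integral_mono (((hsq k).const_mul _).sub (integrable_const _)) (hFint k) fun ω => hlower _
  rw [integral_sub ((hsq k).const_mul _) (integrable_const _), integral_const_mul] at hlow
  simp only [integral_const, probReal_univ, one_smul] at hlow
  have hk := hall k
  have hfin : ∫ ω, ‖X k ω‖ ^ 2 ∂P ≤
      2 / m * (M / 2 * R ^ 2 + B * R + A + C + b / 2 * Real.log 3) := by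
    rw [div_mul_eq_mul_div, le_div_iff₀ hm]
    linarith
  refine hfin.trans ?_
  have hslack : 0 ≤ 6 * (M + B) * M * β⁻¹ * d / m ^ 3 := by positivity
  have e : 2 / m * (M / 2 * R ^ 2 + B * R + A + C + b / 2 * Real.log 3)
      + 6 * (M + B) * M * β⁻¹ * d / m ^ 3 =
      (M * R ^ 2 + 2 * B * R + B + 4 * A) / m + 8 * (M + B) * M * β⁻¹ * d / m ^ 3 +
        2 * (M + B) * b / m ^ 2 + b / m * Real.log 3 := by
    rw [hC]
    field_simp
    ring
  linarith

end
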